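/- arXiv:1705.04791 — 2 statements merged into one kernel-verified Lean document; each statement's English description precedes it below -/
import Mathlib

section
/- Let λ = (λ_1 ≥ ⋯ ≥ λ_r > 0) be a partition of length r ≤ n and define the Hall–Littlewood Q-polynomial Q_λ(x_n;t) := (1−t)^r Σ_{w∈C(r,n)} w·( ∏_{i=1}^{r} x_i^{λ_i} · ∏_{i=1}^{r} ∏_{j=i+1}^{n} (x_i − t x_j)/(x_i − x_j) ). Then Q_λ(x_n;t) = [u_1^{−λ_1}⋯u_r^{−λ_r}]( ∏_{i=1}^{r} ∏_{j=1}^{n} (u_i − t x_j)/(u_i − x_j) · ∏_{1≤i<j≤r} (u_j − u_i)/(u_j − t u_i) ), the coefficient being taken in Λ. This is the additive specialization of the generating-function theorem for the universal Hall–Littlewood Q-functions, generalizing Macdonald's formula III (2.15). -/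
open Finset

noncomputable section

instance finWF (r : ℕ) : WellFoundedLT (Fin r) :=
  inferInstanceAs (IsWellFounded (Fin r) (· < ·))

/-- The field `ℚ(x_1, …, x_n, t)` of rational functions. -/
abbrev K (n : ℕ) : Type := FractionRing (MvPolynomial (Fin n ⊕ Unit) ℚ)

/-- The indeterminate `x_i` (`0`-indexed). -/
def x (n : ℕ) (i : Fin n) : K n :=
  algebraMap (MvPolynomial (Fin n ⊕ Unit) ℚ) (K n) (MvPolynomial.X (Sum.inl i))

/-- The indeterminate `t`. -/
def t (n : ℕ) : K n :=
  algebraMap (MvPolynomial (Fin n ⊕ Unit) ℚ) (K n) (MvPolynomial.X (Sum.inr ()))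

/-- The coset representatives `C(r,n)`. -/
def Cperm (r n : ℕ) : Finset (Equiv.Perm (Fin n)) :=
  Finset.univ.filter fun w => ∀ i j : Fin n, r ≤ (i : ℕ) → i < j → w i < w j

/-- The iterated formal Laurent series field `Λ = K((u_1⁻¹))⋯((u_r⁻¹))`, realized inside the
Hahn series field over the lexicographically ordered group `ℤ^r`. -/
abbrev H (n r : ℕ) := HahnSeries (Lex (Fin r → ℤ)) (K n)

/-- The variable `u_i` (`0`-indexed). -/
def u (n r : ℕ) (i : Fin r) : H n r :=
  HahnSeries.single (toLex (Pi.single (Fin.rev i) (-1 : ℤ))) 1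

section SupportSubring

variable {Γ R : Type*} [AddCommGroup Γ] [LinearOrder Γ] [IsOrderedAddMonoid Γ] [Field R]

/-- The subring of Hahn series whose support is contained in a given submonoid. -/
def supportSubring (R : Type*) [Field R] (M : AddSubmonoid Γ) : Subring (HahnSeries Γ R) where
  carrier := {f | ∀ a, f.coeff a ≠ 0 → a ∈ M}
  mul_mem' := by
    intro f g hf hg a ha
    obtain ⟨b, hb, c, hc, rfl⟩ := HahnSeries.support_mul_subset ((HahnSeries.mem_support _ _).2 ha)
    exact M.add_mem (hf b hb) (hg c hc)
  one_mem' := by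
    intro a ha
    rw [HahnSeries.coeff_one] at ha
    obtain rfl : a = 0 := by by_contra h; simp [h] at ha
    exact M.zero_mem
  add_mem' := by
    intro f g hf hg a ha
    by_cases h : f.coeff a = 0
    · exact hg a (by simpa [h] using ha)
    · exact hf a h
  zero_mem' := by simp
  neg_mem' := by
    intro f hf a ha
    exact hf a (by simpa using ha)

variable {M : AddSubmonoid Γ}

lemma coeff_eq_zero_of_mem_supportSubring {f : HahnSeries Γ R} (hf : f ∈ supportSubring R M)
    {a : Γ} (ha : a ∉ M) : f.coeff a = 0 := by
  by_contra h
  exact ha (hf a h)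

lemma supportSubring_mono {N : AddSubmonoid Γ} (h : M ≤ N) :
    supportSubring R M ≤ supportSubring R N :=
  fun _ hf a ha => h (hf a ha)

lemma single_mem_supportSubring {a : Γ} (ha : a ∈ M) (c : R) :
    HahnSeries.single a c ∈ supportSubring R M := by
  intro b hb
  rwa [HahnSeries.eq_of_mem_support_single ((HahnSeries.mem_support _ _).2 hb)]

lemma C_mem_supportSubring (c : R) : HahnSeries.C c ∈ supportSubring R M :=
  single_mem_supportSubring M.zero_mem c

lemma inv_one_sub_mem_supportSubring {f : HahnSeries Γ R} (hf : f ∈ supportSubring R M)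
    (h0 : 0 < f.orderTop) : (1 - f)⁻¹ ∈ supportSubring R M := by
  rw [inv_eq_of_mul_eq_one_right (HahnSeries.SummableFamily.one_sub_self_mul_hsum_powers h0)]
  intro a ha
  rw [HahnSeries.SummableFamily.coeff_hsum] at ha
  obtain ⟨m, hm⟩ : ∃ m, (HahnSeries.SummableFamily.powers f m).coeff a ≠ 0 := by
    by_contra! h
    exact ha (finsum_eq_zero_of_forall_eq_zero h)
  rw [HahnSeries.SummableFamily.powers_of_orderTop_pos h0] at hm
  exact pow_mem hf m a hm

lemma inv_single_sub_single_mem_supportSubring {a b : Γ} (hab : a < b) (c : R)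
    (ha : -a ∈ M) (hb : b - a ∈ M) :
    (HahnSeries.single a (1 : R) - HahnSeries.single b c)⁻¹ ∈ supportSubring R M := by
  have h : HahnSeries.single a (1 : R) - HahnSeries.single b c =
      HahnSeries.single a 1 * (1 - HahnSeries.single (b - a) c) := by
    rw [mul_sub, HahnSeries.single_mul_single]
    simp
  rw [h, mul_inv, HahnSeries.inv_single]
  refine mul_mem (single_mem_supportSubring ha _)
    (inv_one_sub_mem_supportSubring (single_mem_supportSubring hb c) ?_)
  exact HahnSeries.lt_orderTop_single (sub_pos.2 hab)

end SupportSubring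

lemma single_sub_single_ne_zero {Γ R : Type*} [LinearOrder Γ] [Field R] {a b : Γ} (hab : a < b)
    (c : R) :
    HahnSeries.single a (1 : R) - HahnSeries.single b c ≠ 0 := by
  intro h
  have := congrArg (fun f => f.coeff a) h
  simp [HahnSeries.coeff_single_of_ne hab.ne] at this

lemma prod_sub_mul_div_sub_eq {F ι : Type*} [Field F] [DecidableEq ι] (s : Finset ι) (y : ι → F)
    (hy : Set.InjOn y s) (q v : F) (hv : ∀ i ∈ s, v ≠ y i) :
    ∏ j ∈ s, (v - q * y j) / (v - y j) =
      1 + ∑ i ∈ s, (1 - q) * y i * (∏ j ∈ s.erase i, (y i - q * y j) / (y i - y j)) *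
        (v - y i)⁻¹ := by
  classical
  set P : Polynomial F :=
    ∏ j ∈ s, (Polynomial.X - Polynomial.C (q * y j)) - Lagrange.nodal s y with hP
  have hdeg : P.degree < s.card := by
    have hd : (∏ j ∈ s, (Polynomial.X - Polynomial.C (q * y j))).degree =
        (Lagrange.nodal s y).degree := by
      rw [Lagrange.degree_nodal, Polynomial.degree_prod]
      simp only [Polynomial.degree_X_sub_C]
      simp
    have h := Polynomial.degree_sub_lt_left hd
      (Polynomial.monic_prod_of_monic _ _ fun j _ => Polynomial.monic_X_sub_C _).ne_zero
      (by rw [(Polynomial.monic_prod_of_monic _ _ fun j _ =>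
          Polynomial.monic_X_sub_C _).leadingCoeff, (Lagrange.nodal_monic).leadingCoeff])
    rwa [hd, Lagrange.degree_nodal] at h
  have hn : ∏ j ∈ s, (v - y j) ≠ 0 := Finset.prod_ne_zero_iff.2 fun j hj => sub_ne_zero.2 (hv j hj)
  have h := congrArg (Polynomial.eval v) (Lagrange.eq_interpolate hy hdeg)
  rw [Lagrange.eval_interpolate_not_at_node _ hv, hP, Polynomial.eval_sub, Lagrange.eval_nodal,
    Polynomial.eval_prod, sub_eq_iff_eq_add] at h
  simp only [Polynomial.eval_sub, Polynomial.eval_X, Polynomial.eval_C, Polynomial.eval_prod] at h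
  rw [Finset.prod_div_distrib, div_eq_iff hn, h, add_mul, one_mul, mul_comm _ (∏ j ∈ s, _),
    add_comm]
  congr 2
  refine Finset.sum_congr rfl fun i hi => ?_
  rw [Lagrange.eval_nodal_at_node hi, sub_zero, ← Finset.mul_prod_erase _ _ hi,
    Finset.prod_div_distrib, Lagrange.nodalWeight, Finset.prod_inv_distrib]
  ring

section Generating

variable {n r m : ℕ}

/-- The exponent of `(u i)⁻¹`, as a homomorphism on monomials. -/
def exponent (i : Fin r) : Lex (Fin r → ℤ) →+ ℤ where
  toFun a := ofLex a (Fin.rev i)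
  map_zero' := rfl
  map_add' _ _ := rfl

/-- The monomial `(u i)⁻¹`. -/
def unitExponent (i : Fin r) : Lex (Fin r → ℤ) := toLex (Pi.single (Fin.rev i) 1)

lemma exponent_unitExponent (i j : Fin r) :
    exponent i (unitExponent j) = if i = j then 1 else 0 := by
  simp [exponent, unitExponent, Pi.single_apply]

lemma u_eq_single (i : Fin r) : u n r i = HahnSeries.single (-unitExponent i) 1 := by
  rw [u, unitExponent, ← toLex_neg, Pi.single_neg]

lemma unitExponent_pos (i : Fin r) : 0 < unitExponent i :=
  Pi.toLex_strictMono (Pi.single_pos.2 (zero_lt_one (α := ℤ)))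

lemma unitExponent_lt {i j : Fin r} (hij : i < j) : unitExponent i < unitExponent j := by
  refine ⟨Fin.rev j, fun k hk => ?_, ?_⟩
  · have h1 : k ≠ Fin.rev i := (hk.trans (Fin.rev_lt_rev.2 hij)).ne
    simp [unitExponent, h1, hk.ne]
  · simp [unitExponent, hij.ne']

lemma u_ne_zero (i : Fin r) : u n r i ≠ 0 := by
  simp [u]

lemma u_sub_C_eq (i : Fin r) (c : K n) :
    u n r i - HahnSeries.C c =
      HahnSeries.single (-unitExponent i) 1 - HahnSeries.single 0 c := by
  rw [u_eq_single]; rfl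

lemma u_sub_C_mul_u_eq (i j : Fin r) (c : K n) :
    u n r j - HahnSeries.C c * u n r i =
      HahnSeries.single (-unitExponent j) 1 - HahnSeries.single (-unitExponent i) c := by
  rw [u_eq_single, u_eq_single, HahnSeries.C_apply, HahnSeries.single_mul_single, zero_add, mul_one]

lemma u_sub_C_ne_zero (i : Fin r) (c : K n) : u n r i - HahnSeries.C c ≠ 0 := by
  rw [u_sub_C_eq]
  exact single_sub_single_ne_zero (neg_neg_iff_pos.2 (unitExponent_pos i)) c

lemma u_sub_C_mul_u_ne_zero {i j : Fin r} (hij : i < j) (c : K n) :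
    u n r j - HahnSeries.C c * u n r i ≠ 0 := by
  rw [u_sub_C_mul_u_eq]
  exact single_sub_single_ne_zero (neg_lt_neg (unitExponent_lt hij)) c

section Membership

variable {M : AddSubmonoid (Lex (Fin r → ℤ))}

lemma u_mem_supportSubring {i : Fin r} (h : -unitExponent i ∈ M) :
    u n r i ∈ supportSubring (K n) M := by
  rw [u_eq_single]
  exact single_mem_supportSubring h _

lemma inv_u_sub_C_mem_supportSubring {i : Fin r} (h : unitExponent i ∈ M) (c : K n) :
    (u n r i - HahnSeries.C c)⁻¹ ∈ supportSubring (K n) M := by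
  rw [u_sub_C_eq]
  exact inv_single_sub_single_mem_supportSubring (neg_neg_iff_pos.2 (unitExponent_pos i)) c
    (by simpa using h) (by simpa using h)

lemma inv_u_sub_C_mul_u_mem_supportSubring {i j : Fin r} (hij : i < j)
    (hj : unitExponent j ∈ M) (hi : -unitExponent i ∈ M) (c : K n) :
    (u n r j - HahnSeries.C c * u n r i)⁻¹ ∈ supportSubring (K n) M := by
  rw [u_sub_C_mul_u_eq]
  refine inv_single_sub_single_mem_supportSubring (neg_lt_neg (unitExponent_lt hij)) c
    (by simpa using hj) ?_
  rw [sub_neg_eq_add]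
  exact M.add_mem hi hj

end Membership

/-- Monomials not involving `u i`. -/
def freeOf (i : Fin r) : AddSubmonoid (Lex (Fin r → ℤ)) := (⊥ : AddSubmonoid ℤ).comap (exponent i)

/-- Monomials in which `u i` has nonpositive degree. -/
def nonposDegree (i : Fin r) : AddSubmonoid (Lex (Fin r → ℤ)) :=
  (AddSubmonoid.nonneg ℤ).comap (exponent i)

/-- Monomials in which `u i` has nonnegative degree. -/
def nonnegDegree (i : Fin r) : AddSubmonoid (Lex (Fin r → ℤ)) :=
  (AddSubmonoid.nonneg ℤ).comap (-exponent i)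

lemma mem_freeOf {i : Fin r} {a : Lex (Fin r → ℤ)} : a ∈ freeOf i ↔ exponent i a = 0 := Iff.rfl

lemma mem_nonposDegree {i : Fin r} {a : Lex (Fin r → ℤ)} :
    a ∈ nonposDegree i ↔ 0 ≤ exponent i a := Iff.rfl

lemma mem_nonnegDegree {i : Fin r} {a : Lex (Fin r → ℤ)} :
    a ∈ nonnegDegree i ↔ exponent i a ≤ 0 := by
  change 0 ≤ -(exponent i a) ↔ _
  simp

lemma freeOf_le_nonposDegree (i : Fin r) : freeOf i ≤ nonposDegree i :=
  fun _ h => (mem_freeOf.1 h).ge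

lemma freeOf_le_nonnegDegree (i : Fin r) : freeOf i ≤ nonnegDegree i :=
  fun _ h => mem_nonnegDegree.2 (mem_freeOf.1 h).le

lemma unitExponent_mem_freeOf {i j : Fin r} (h : i ≠ j) : unitExponent j ∈ freeOf i := by
  rw [mem_freeOf, exponent_unitExponent, if_neg h]

lemma neg_unitExponent_mem_freeOf {i j : Fin r} (h : i ≠ j) : -unitExponent j ∈ freeOf i := by
  rw [mem_freeOf, map_neg, exponent_unitExponent, if_neg h, neg_zero]

/-- Extracting a coefficient of negative degree in `u i` from a geometric series in `(u i)⁻¹`. -/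
lemma coeff_mul_inv_u_sub_C (i : Fin r) {f : H n r} (hf : f ∈ supportSubring (K n) (freeOf i))
    (c : K n) {a : Lex (Fin r → ℤ)} (ha : exponent i a = 0) (k : ℕ) :
    (f * (u n r i - HahnSeries.C c)⁻¹).coeff (a + (k + 1) • unitExponent i) =
      c ^ k * f.coeff a := by
  set g := f * (u n r i - HahnSeries.C c)⁻¹ with hg
  have hgM : g ∈ supportSubring (K n) (nonposDegree i) :=
    mul_mem (supportSubring_mono (freeOf_le_nonposDegree i) hf)
      (inv_u_sub_C_mem_supportSubring
        (mem_nonposDegree.2 (by simp [exponent_unitExponent])) c)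
  have hrec (b : Lex (Fin r → ℤ)) :
      g.coeff (b + unitExponent i) = f.coeff b + c * g.coeff b := by
    have h1 : u n r i * g = f + HahnSeries.C c * g := by
      linear_combination f * mul_inv_cancel₀ (u_sub_C_ne_zero i c)
    have h2 := congrArg (fun h => h.coeff b) h1
    simpa [u_eq_single, HahnSeries.coeff_single_mul] using h2
  have hg0 : g.coeff a = 0 := by
    have h := hrec (a - unitExponent i)
    rw [sub_add_cancel] at h
    rw [h, coeff_eq_zero_of_mem_supportSubring hf, coeff_eq_zero_of_mem_supportSubring hgM]
    · simp
    · simp [mem_nonposDegree, exponent_unitExponent, ha]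
    · simp [mem_freeOf, exponent_unitExponent, ha]
  induction k with
  | zero => simp [hrec, hg0]
  | succ k ih =>
    rw [succ_nsmul, ← add_assoc, hrec, ih, coeff_eq_zero_of_mem_supportSubring hf]
    · ring
    · rw [mem_freeOf, map_add, map_nsmul, exponent_unitExponent, if_pos rfl, ha]
      simp only [nsmul_eq_mul]
      push_cast
      omega

/-- The Hall–Littlewood sum over injective sequences in the index set `A`. -/
def hallLittlewoodSum (lam : Fin m → ℕ) (A : Finset (Fin n)) : K n :=
  ∑ a : Fin m → Fin n with Function.Injective a ∧ ∀ i, a i ∈ A,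
    ∏ i, (1 - t n) * x n (a i) ^ lam i *
      ∏ b ∈ A with ∀ j ≤ i, b ≠ a j, (x n (a i) - t n * x n b) / (x n (a i) - x n b)

lemma hallLittlewoodSum_succ (lam : Fin (m + 1) → ℕ) (A : Finset (Fin n)) :
    hallLittlewoodSum lam A =
      ∑ a ∈ A, (1 - t n) * x n a ^ lam 0 *
        (∏ b ∈ A.erase a, (x n a - t n * x n b) / (x n a - x n b)) *
          hallLittlewoodSum (fun i => lam i.succ) (A.erase a) := by
  classical
  rw [hallLittlewoodSum, Finset.sum_filter, ← (Fin.consEquiv fun _ => Fin n).sum_comp,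
    Fintype.sum_prod_type, ← Finset.sum_subset (Finset.subset_univ A)]
  · refine Finset.sum_congr rfl fun a ha => ?_
    rw [hallLittlewoodSum, Finset.mul_sum, Finset.sum_filter]
    refine Finset.sum_congr rfl fun s _ => ?_
    have hcond : (Function.Injective (Fin.cons a s : Fin (m + 1) → Fin n) ∧
          ∀ i, (Fin.cons a s : Fin (m + 1) → Fin n) i ∈ A) ↔
        Function.Injective s ∧ ∀ i, s i ∈ A.erase a := by
      rw [Fin.cons_injective_iff, Fin.forall_fin_succ]
      simp only [Fin.cons_zero, Fin.cons_succ, Set.mem_range, not_exists, Finset.mem_erase,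
        forall_and]
      tauto
    have h0 : (A.filter fun b => ∀ j ≤ (0 : Fin (m + 1)),
        b ≠ (Fin.cons a s : Fin (m + 1) → Fin n) j) = A.erase a := by
      ext b
      simp [and_comm]
    have hs (i : Fin m) : (A.filter fun b => ∀ j ≤ i.succ,
        b ≠ (Fin.cons a s : Fin (m + 1) → Fin n) j) =
          (A.erase a).filter fun b => ∀ j ≤ i, b ≠ s j := by
      ext b
      simp [Fin.forall_fin_succ]
      tauto
    simp only [Fin.consEquiv_apply, Fin.prod_univ_succ, Fin.cons_zero, Fin.cons_succ, h0, hs]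
    exact if_congr hcond rfl rfl
  · intro a _ ha
    refine Finset.sum_eq_zero fun s _ => if_neg fun h => ha ?_
    simpa using h.2 0

/-- The generating function in the variables `u (ι i)` and `x a` for `a ∈ A`. -/
def genFun (ι : Fin m → Fin r) (A : Finset (Fin n)) : H n r :=
  (∏ i, ∏ j ∈ A, (u n r (ι i) - HahnSeries.C (t n) * HahnSeries.C (x n j)) /
      (u n r (ι i) - HahnSeries.C (x n j))) *
    ∏ i, ∏ j ∈ Finset.Ioi i,
      (u n r (ι j) - u n r (ι i)) / (u n r (ι j) - HahnSeries.C (t n) * u n r (ι i))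

lemma genFun_succ (ι : Fin (m + 1) → Fin r) (A : Finset (Fin n)) :
    genFun ι A =
      (∏ j ∈ A, (u n r (ι 0) - HahnSeries.C (t n) * HahnSeries.C (x n j)) /
          (u n r (ι 0) - HahnSeries.C (x n j))) *
        (∏ k : Fin m, (u n r (ι k.succ) - u n r (ι 0)) /
          (u n r (ι k.succ) - HahnSeries.C (t n) * u n r (ι 0))) *
        genFun (fun i => ι i.succ) A := by
  simp only [genFun, Fin.prod_univ_succ, Fin.prod_Ioi_zero, Fin.prod_Ioi_succ]
  ring

lemma genFun_erase (ι : Fin m → Fin r) {A : Finset (Fin n)} {a : Fin n} (ha : a ∈ A) :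
    (∏ k, (u n r (ι k) - HahnSeries.C (x n a)) /
        (u n r (ι k) - HahnSeries.C (t n) * HahnSeries.C (x n a))) * genFun ι A =
      genFun ι (A.erase a) := by
  rw [genFun, genFun, ← mul_assoc, ← Finset.prod_mul_distrib]
  congr 1
  refine Finset.prod_congr rfl fun k _ => ?_
  have h1 := u_sub_C_ne_zero (n := n) (ι k) (x n a)
  have h2 := u_sub_C_ne_zero (n := n) (ι k) (t n * x n a)
  rw [map_mul] at h2
  rw [← Finset.mul_prod_erase _ _ ha, ← mul_assoc, div_mul_div_cancel₀' h1, div_self h2, one_mul]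

lemma genFun_mem {ι : Fin m → Fin r} (hι : StrictMono ι) (A : Finset (Fin n)) {i : Fin r}
    (hi : ∀ k, i ≠ ι k) : genFun ι A ∈ supportSubring (K n) (freeOf i) := by
  refine mul_mem (prod_mem fun k _ => prod_mem fun j _ => ?_)
    (prod_mem fun k _ => prod_mem fun l hl => ?_)
  · exact mul_mem (sub_mem (u_mem_supportSubring (neg_unitExponent_mem_freeOf (hi k)))
      (mul_mem (C_mem_supportSubring _) (C_mem_supportSubring _)))
      (inv_u_sub_C_mem_supportSubring (unitExponent_mem_freeOf (hi k)) _)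
  · exact mul_mem (sub_mem (u_mem_supportSubring (neg_unitExponent_mem_freeOf (hi l)))
      (u_mem_supportSubring (neg_unitExponent_mem_freeOf (hi k))))
      (inv_u_sub_C_mul_u_mem_supportSubring (hι (Finset.mem_Ioi.1 hl))
        (unitExponent_mem_freeOf (hi l)) (neg_unitExponent_mem_freeOf (hi k)) _)

lemma prod_sub_prod_mul_mem {R κ : Type*} [CommRing R] (S : Subring R) (s : Finset κ)
    {p q : κ → R} (z : R) (hp : ∀ k ∈ s, p k ∈ S) (hq : ∀ k ∈ s, q k ∈ S)
    (hpq : ∀ k ∈ s, (p k - q k) * z ∈ S) :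
    ((∏ k ∈ s, p k) - ∏ k ∈ s, q k) * z ∈ S := by
  classical
  induction s using Finset.induction_on with
  | empty => simp
  | insert k s hk ih =>
    simp only [Finset.forall_mem_insert] at hp hq hpq
    rw [Finset.prod_insert hk, Finset.prod_insert hk]
    have h : (p k * ∏ i ∈ s, p i - q k * ∏ i ∈ s, q i) * z =
        (p k - q k) * z * ∏ i ∈ s, p i + q k * (((∏ i ∈ s, p i) - ∏ i ∈ s, q i) * z) := by ring
    rw [h]
    exact add_mem (mul_mem hpq.1 (prod_mem hp.2)) (mul_mem hq.1 (ih hp.2 hq.2 hpq.2))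

section Interaction

variable {i k : Fin r}

lemma neg_unitExponent_self_mem_nonnegDegree (i : Fin r) :
    -unitExponent i ∈ nonnegDegree i := by
  rw [mem_nonnegDegree, map_neg, exponent_unitExponent, if_pos rfl]
  norm_num

lemma interaction_mem (hik : i < k) :
    (u n r k - u n r i) / (u n r k - HahnSeries.C (t n) * u n r i) ∈
      supportSubring (K n) (nonnegDegree i) :=
  mul_mem (sub_mem
    (u_mem_supportSubring (freeOf_le_nonnegDegree i (neg_unitExponent_mem_freeOf hik.ne)))
    (u_mem_supportSubring (neg_unitExponent_self_mem_nonnegDegree i)))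
    (inv_u_sub_C_mul_u_mem_supportSubring hik
      (freeOf_le_nonnegDegree i (unitExponent_mem_freeOf hik.ne))
      (neg_unitExponent_self_mem_nonnegDegree i) _)

lemma specialized_interaction_mem (hik : i < k) (c : K n) :
    (u n r k - HahnSeries.C c) / (u n r k - HahnSeries.C (t n) * HahnSeries.C c) ∈
      supportSubring (K n) (nonnegDegree i) := by
  rw [← map_mul]
  exact mul_mem (sub_mem
    (u_mem_supportSubring (freeOf_le_nonnegDegree i (neg_unitExponent_mem_freeOf hik.ne)))
    (C_mem_supportSubring _))
    (inv_u_sub_C_mem_supportSubring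
      (freeOf_le_nonnegDegree i (unitExponent_mem_freeOf hik.ne)) _)

lemma interaction_sub_mul_inv_mem (hik : i < k) (c : K n) :
    ((u n r k - u n r i) / (u n r k - HahnSeries.C (t n) * u n r i) -
      (u n r k - HahnSeries.C c) / (u n r k - HahnSeries.C (t n) * HahnSeries.C c)) *
        (u n r i - HahnSeries.C c)⁻¹ ∈ supportSubring (K n) (nonnegDegree i) := by
  have h1 := u_sub_C_mul_u_ne_zero hik (t n)
  have h2 := u_sub_C_ne_zero (n := n) k (t n * c)
  have h3 := u_sub_C_ne_zero (n := n) i c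
  rw [map_mul] at h2
  have h : ((u n r k - u n r i) / (u n r k - HahnSeries.C (t n) * u n r i) -
      (u n r k - HahnSeries.C c) / (u n r k - HahnSeries.C (t n) * HahnSeries.C c)) *
        (u n r i - HahnSeries.C c)⁻¹ =
      (HahnSeries.C (t n) - 1) * u n r k * (u n r k - HahnSeries.C (t n) * u n r i)⁻¹ *
        (u n r k - HahnSeries.C (t n) * HahnSeries.C c)⁻¹ := by
    rw [div_sub_div _ _ h1 h2, ← div_eq_mul_inv, div_div, ← div_eq_mul_inv, ← div_eq_mul_inv,
      div_div, div_eq_div_iff (mul_ne_zero (mul_ne_zero h1 h2) h3) (mul_ne_zero h1 h2)]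
    ring
  rw [h, ← map_mul]
  have hk := freeOf_le_nonnegDegree i (unitExponent_mem_freeOf hik.ne)
  have hk' := freeOf_le_nonnegDegree i (neg_unitExponent_mem_freeOf hik.ne)
  exact mul_mem (mul_mem (mul_mem (sub_mem (C_mem_supportSubring _) (one_mem _))
    (u_mem_supportSubring hk')) (inv_u_sub_C_mul_u_mem_supportSubring hik hk
      (neg_unitExponent_self_mem_nonnegDegree i) _)) (inv_u_sub_C_mem_supportSubring hk _)

end Interaction

lemma x_injective : Function.Injective (x n) := fun i j h => by
  simpa using MvPolynomial.X_injective (IsFractionRing.injective _ (K n) h)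

/-- Modulo series without negative powers of `u (ι 0)`, only the poles at `u (ι 0) = x a`
contribute. -/
lemma genFun_succ_sub_mem {ι : Fin (m + 1) → Fin r} (hι : StrictMono ι) (A : Finset (Fin n)) :
    genFun ι A - ∑ a ∈ A,
        HahnSeries.C ((1 - t n) * x n a *
          ∏ b ∈ A.erase a, (x n a - t n * x n b) / (x n a - x n b)) *
        (genFun (fun k => ι k.succ) (A.erase a) * (u n r (ι 0) - HahnSeries.C (x n a))⁻¹) ∈
      supportSubring (K n) (nonnegDegree (ι 0)) := by
  have hlt (k : Fin m) : ι 0 < ι k.succ := hι (Fin.succ_pos k)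
  have hι' : StrictMono fun k : Fin m => ι k.succ := hι.comp (Fin.strictMono_succ)
  have hmem : genFun (fun k => ι k.succ) A ∈ supportSubring (K n) (nonnegDegree (ι 0)) :=
    supportSubring_mono (freeOf_le_nonnegDegree _) (genFun_mem hι' A fun k => (hlt k).ne)
  have hpf := prod_sub_mul_div_sub_eq A (fun j => (HahnSeries.C (x n j) : H n r))
    ((HahnSeries.C_injective.comp x_injective).injOn) (HahnSeries.C (t n)) (u n r (ι 0))
    fun j _ => sub_ne_zero.1 (u_sub_C_ne_zero _ _)
  rw [genFun_succ, hpf]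
  set F := ∏ k : Fin m, (u n r (ι k.succ) - u n r (ι 0)) /
    (u n r (ι k.succ) - HahnSeries.C (t n) * u n r (ι 0)) with hF
  set R := genFun (fun k => ι k.succ) A with hR
  have hFmem : F ∈ supportSubring (K n) (nonnegDegree (ι 0)) :=
    prod_mem fun k _ => interaction_mem (hlt k)
  rw [add_mul, add_mul, one_mul, add_sub_assoc, Finset.sum_mul, Finset.sum_mul,
    ← Finset.sum_sub_distrib]
  refine add_mem (mul_mem hFmem hmem) (sum_mem fun a ha => ?_)
  rw [← genFun_erase _ ha, ← hR]
  have hC : (HahnSeries.C ((1 - t n) * x n a *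
        ∏ b ∈ A.erase a, (x n a - t n * x n b) / (x n a - x n b)) : H n r) =
      (1 - HahnSeries.C (t n)) * HahnSeries.C (x n a) *
        ∏ b ∈ A.erase a, (HahnSeries.C (x n a) - HahnSeries.C (t n) * HahnSeries.C (x n b)) /
          (HahnSeries.C (x n a) - HahnSeries.C (x n b)) := by
    simp only [map_mul, map_sub, map_prod, map_div₀, map_one]
  rw [← hC]
  have h := prod_sub_prod_mul_mem (supportSubring (K n) (nonnegDegree (ι 0))) Finset.univ
    (u n r (ι 0) - HahnSeries.C (x n a))⁻¹ (fun k _ => interaction_mem (n := n) (hlt k))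
    (fun k _ => specialized_interaction_mem (hlt k) (x n a))
    fun k _ => interaction_sub_mul_inv_mem (hlt k) (x n a)
  rw [← hF] at h
  have h' := mul_mem (mul_mem (C_mem_supportSubring (M := nonnegDegree (ι 0)) ((1 - t n) * x n a *
        ∏ b ∈ A.erase a, (x n a - t n * x n b) / (x n a - x n b))) h) hmem
  convert h' using 1
  ring

theorem coeff_genFun (ι : Fin m → Fin r) (hι : StrictMono ι) (lam : Fin m → ℕ)
    (hpos : ∀ i, 0 < lam i) (A : Finset (Fin n)) :
    (genFun ι A).coeff (∑ i, lam i • unitExponent (ι i)) = hallLittlewoodSum lam A := by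
  induction m generalizing A with
  | zero =>
    simp [genFun, hallLittlewoodSum, Function.injective_of_subsingleton]
  | succ m ih =>
    have hlt (k : Fin m) : ι 0 < ι k.succ := hι (Fin.succ_pos k)
    have hι' : StrictMono fun k : Fin m => ι k.succ := hι.comp (Fin.strictMono_succ)
    have hexp : exponent (ι 0) (∑ k : Fin m, lam k.succ • unitExponent (ι k.succ)) = 0 := by
      simp only [map_sum, map_nsmul, exponent_unitExponent, (hlt _).ne, if_false, smul_zero,
        Finset.sum_const_zero]
    obtain ⟨l, hl⟩ := Nat.exists_eq_succ_of_ne_zero (hpos 0).ne'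
    have h0 := coeff_eq_zero_of_mem_supportSubring (genFun_succ_sub_mem hι A)
      (a := ∑ i, lam i • unitExponent (ι i)) (by
        rw [mem_nonnegDegree, Fin.sum_univ_succ, map_add, hexp, map_nsmul, exponent_unitExponent,
          if_pos rfl]
        have := hpos 0
        simp
        omega)
    rw [HahnSeries.coeff_sub, sub_eq_zero] at h0
    rw [h0, HahnSeries.coeff_sum, hallLittlewoodSum_succ]
    refine Finset.sum_congr rfl fun a _ => ?_
    have hsum : ∑ i, lam i • unitExponent (ι i) =
        ∑ k : Fin m, lam k.succ • unitExponent (ι k.succ) + (l + 1) • unitExponent (ι 0) := by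
      rw [Fin.sum_univ_succ, hl, add_comm]
    rw [HahnSeries.C_apply, HahnSeries.coeff_single_zero_mul, hsum, hl,
      coeff_mul_inv_u_sub_C _ (genFun_mem hι' _ fun k => (hlt k).ne) _ hexp,
      ih _ hι' _ fun i => hpos _, pow_succ]
    ring

lemma Cperm_tail_eq_orderEmbOfFin (hrn : r ≤ n) {w : Equiv.Perm (Fin n)} (hw : w ∈ Cperm r n)
    (a : Fin r → Fin n) (ha : ∀ i, w (Fin.castLE hrn i) = a i)
    (hcard : (Finset.univ.filter fun b => ∀ i, b ≠ a i).card = n - r) (k : Fin (n - r)) :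
    w ⟨r + k, by omega⟩ = Finset.orderEmbOfFin _ hcard k := by
  refine congrFun (Finset.orderEmbOfFin_unique hcard
    (f := fun k : Fin (n - r) => w ⟨r + k, by omega⟩) (fun k => ?_) fun k l hkl => ?_) k
  · simp only [Finset.mem_filter, Finset.mem_univ, true_and, ← ha]
    intro i h
    have := congrArg Fin.val (w.injective h)
    simp at this
    omega
  · exact (Finset.mem_filter.1 hw).2 _ _ (by simp) (by simpa using hkl)

lemma card_filter_forall_ne {a : Fin r → Fin n} (ha : Function.Injective a) :
    (Finset.univ.filter fun b => ∀ i, b ≠ a i).card = n - r := by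
  classical
  have h : (Finset.univ.filter fun b => ∀ i, b ≠ a i) = (Finset.univ.image a)ᶜ := by
    ext b
    simp [eq_comm]
  rw [h, Finset.card_compl, Finset.card_image_of_injective _ ha]
  simp

lemma Cperm_ext (hrn : r ≤ n) {w w' : Equiv.Perm (Fin n)} (hw : w ∈ Cperm r n)
    (hw' : w' ∈ Cperm r n) (h : ∀ i, w (Fin.castLE hrn i) = w' (Fin.castLE hrn i)) : w = w' := by
  have hcard := card_filter_forall_ne (w'.injective.comp (Fin.castLE_injective hrn))
  ext1 j
  by_cases hj : (j : ℕ) < r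
  · exact h ⟨j, hj⟩
  · have e : j = ⟨r + (⟨j - r, by omega⟩ : Fin (n - r)), by simp; omega⟩ := by
      ext
      simp
      omega
    rw [e, Cperm_tail_eq_orderEmbOfFin hrn hw _ h hcard,
      Cperm_tail_eq_orderEmbOfFin hrn hw' _ (fun _ => rfl) hcard]

lemma exists_mem_Cperm (hrn : r ≤ n) {a : Fin r → Fin n} (ha : Function.Injective a) :
    ∃ w ∈ Cperm r n, ∀ i, w (Fin.castLE hrn i) = a i := by
  have hcard := card_filter_forall_ne ha
  set e := Finset.orderEmbOfFin _ hcard with he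
  have hmem (k : Fin (n - r)) (i : Fin r) : e k ≠ a i :=
    (Finset.mem_filter.1 (Finset.orderEmbOfFin_mem _ hcard k)).2 i
  let f : Fin n → Fin n := fun j =>
    if hj : (j : ℕ) < r then a ⟨j, hj⟩ else e ⟨j - r, by omega⟩
  have hf : Function.Injective f := by
    intro j k hjk
    by_cases hj : (j : ℕ) < r <;> by_cases hk : (k : ℕ) < r <;>
      simp only [f, hj, hk, dif_pos, dif_neg, not_false_eq_true] at hjk
    · simpa [Fin.ext_iff] using ha hjk
    · exact absurd hjk.symm (hmem _ _)
    · exact absurd hjk (hmem _ _)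
    · have := congrArg Fin.val (e.injective hjk)
      simp only at this
      omega
  refine ⟨Equiv.ofBijective f (Finite.injective_iff_bijective.1 hf), ?_, fun i => ?_⟩
  · refine Finset.mem_filter.2 ⟨Finset.mem_univ _, fun i j hi hij => ?_⟩
    have hij' : (i : ℕ) < j := hij
    rw [Equiv.ofBijective_apply, Equiv.ofBijective_apply]
    simp only [f]
    rw [dif_neg (by omega), dif_neg (by omega)]
    exact e.strictMono (by rw [Fin.lt_def]; simp only; omega)
  · simp [f]

lemma sum_Cperm_eq_hallLittlewoodSum (hrn : r ≤ n) (lam : Fin r → ℕ) :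
    (1 - t n) ^ r *
      (∑ w ∈ Cperm r n,
        (∏ i : Fin r, x n (w (Fin.castLE hrn i)) ^ (lam i)) *
        (∏ i : Fin r, ∏ j ∈ Finset.Ioi (Fin.castLE hrn i),
            (x n (w (Fin.castLE hrn i)) - t n * x n (w j)) /
            (x n (w (Fin.castLE hrn i)) - x n (w j)))) =
      hallLittlewoodSum lam Finset.univ := by
  classical
  rw [hallLittlewoodSum, Finset.mul_sum]
  refine Finset.sum_bij (fun w _ i => w (Fin.castLE hrn i)) ?_ ?_ ?_ ?_
  · intro w _
    refine Finset.mem_filter.2 ⟨Finset.mem_univ _, ?_, fun _ => Finset.mem_univ _⟩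
    exact w.injective.comp (Fin.castLE_injective hrn)
  · exact fun w hw w' hw' h => Cperm_ext hrn hw hw' (congrFun h)
  · intro a ha
    obtain ⟨w, hw, h⟩ := exists_mem_Cperm hrn (Finset.mem_filter.1 ha).2.1
    exact ⟨w, hw, funext h⟩
  · intro w _
    rw [Finset.prod_mul_distrib, Finset.prod_mul_distrib, Finset.prod_const, Finset.card_univ,
      Fintype.card_fin, mul_assoc]
    congr 2
    refine Finset.prod_congr rfl fun i _ => ?_
    refine Finset.prod_bij (fun j _ => w j) ?_ (fun _ _ _ _ h => w.injective h) ?_ fun _ _ => rfl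
    · intro j hj
      have hj' : Fin.castLE hrn i < j := Finset.mem_Ioi.1 hj
      rw [Fin.lt_def, Fin.val_castLE] at hj'
      refine Finset.mem_filter.2 ⟨Finset.mem_univ _, fun k hk h => ?_⟩
      have h1 : (j : ℕ) = k := congrArg Fin.val (w.injective h)
      have h2 : (k : ℕ) ≤ i := hk
      omega
    · intro b hb
      refine ⟨w.symm b, Finset.mem_Ioi.2 (not_le.1 fun h => ?_), w.apply_symm_apply b⟩
      have h' : (w.symm b : ℕ) ≤ i := h
      exact (Finset.mem_filter.1 hb).2 ⟨w.symm b, by omega⟩ h' (w.apply_symm_apply b).symm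

end Generating

/-- **Generating function for the Hall–Littlewood `Q`-polynomials (additive
specialization of the universal Hall–Littlewood `Q`-functions).**

For a partition `λ_1 ≥ ⋯ ≥ λ_r > 0` of length `r ≤ n`,
`Q_λ(x_n;t) = (1−t)^r Σ_{w∈C(r,n)} w·( ∏_i x_i^{λ_i} · ∏_i ∏_{j=i+1}^n (x_i−tx_j)/(x_i−x_j) )`
equals the coefficient of `u_1^{−λ_1}⋯u_r^{−λ_r}` in
`∏_i ∏_{j=1}^n (u_i−tx_j)/(u_i−x_j) · ∏_{1≤i<j≤r} (u_j−u_i)/(u_j−tu_i)`. -/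
theorem hall_littlewood_Q_generating_function
    (n r : ℕ) (hr : 1 ≤ r) (hrn : r ≤ n)
    (lam : Fin r → ℕ) (hpos : ∀ i, 0 < lam i)
    (hanti : ∀ i j : Fin r, i ≤ j → lam j ≤ lam i) :
    (1 - t n) ^ r *
      (∑ w ∈ Cperm r n,
        (∏ i : Fin r, x n (w (Fin.castLE hrn i)) ^ (lam i)) *
        (∏ i : Fin r, ∏ j ∈ Finset.Ioi (Fin.castLE hrn i),
            (x n (w (Fin.castLE hrn i)) - t n * x n (w j)) /
            (x n (w (Fin.castLE hrn i)) - x n (w j))))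
    =
    ((∏ i : Fin r, ∏ j : Fin n,
        (u n r i - HahnSeries.C (t n) * HahnSeries.C (x n j)) /
        (u n r i - HahnSeries.C (x n j))) *
      (∏ i : Fin r, ∏ j ∈ Finset.Ioi i,
        (u n r j - u n r i) / (u n r j - HahnSeries.C (t n) * u n r i))).coeff
        (toLex (fun k : Fin r => (lam (Fin.rev k) : ℤ))) := by
  rw [sum_Cperm_eq_hallLittlewoodSum, ← coeff_genFun id strictMono_id lam hpos]
  have h : ∑ i, lam i • unitExponent (id i) = toLex fun k : Fin r => (lam (Fin.rev k) : ℤ) := by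
    refine ofLex.injective (funext fun k => ?_)
    have hk (a : Lex (Fin r → ℤ)) : ofLex a k = exponent (Fin.rev k) a := by simp [exponent]
    rw [hk, map_sum]
    simp only [map_nsmul, exponent_unitExponent, id]
    simp
  rw [h]
  rfl
end
end

section
/- Let λ = (λ_1 ≥ ⋯ ≥ λ_r > 0) be a partition of length r ≤ n and define HP_λ(x_n;t) := Σ_{w∈C(r,n)} w·( ∏_{i=1}^{r} x_i^{λ_i} · ∏_{i=1}^{r} ∏_{j=i+1}^{n} (x_i − t x_j)/(x_i − x_j) ) (the Hall–Littlewood P-type coset symmetrization). Then HP_λ(x_n;t) = [u_1^{−λ_1}⋯u_r^{−λ_r}]( (1−t)^{−r} ∏_{i=1}^{r} ∏_{j=1}^{n} (u_i − t x_j)/(u_i − x_j) · ∏_{1≤i<j≤r} (u_j − u_i)/(u_j − t u_i) ), the coefficient being taken in Λ. This is the additive specialization of the generating-function theorem for the universal Hall–Littlewood P-functions. -/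
open Finset

noncomputable section

namespace HallLittlewood

section Support

variable {Γ F : Type*} [AddCommGroup Γ] [LinearOrder Γ] [IsOrderedAddMonoid Γ] [Field F]

/-- The Hahn series whose support lies in a given additive submonoid of the exponents. -/
def supportedOn (F : Type*) [Field F] (S : AddSubmonoid Γ) : Subring (HahnSeries Γ F) where
  carrier := {f | f.support ⊆ S}
  mul_mem' {f g} hf hg := by
    refine HahnSeries.support_mul_subset.trans ?_
    rintro _ ⟨a, ha, b, hb, rfl⟩
    exact S.add_mem (hf ha) (hg hb)
  one_mem' := by
    intro a ha
    have : a = 0 := by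
      by_contra h
      simp [h] at ha
    exact this ▸ S.zero_mem
  add_mem' {f g} hf hg := (HahnSeries.support_add_subset f g).trans (Set.union_subset hf hg)
  zero_mem' := by simp
  neg_mem' {f} hf := by simpa using hf

variable {S T : AddSubmonoid Γ}

theorem supportedOn_mono (h : S ≤ T) : supportedOn F S ≤ supportedOn F T :=
  fun _ hf => Set.Subset.trans hf h

theorem coeff_eq_zero_of_mem {f : HahnSeries Γ F} (hf : f ∈ supportedOn F S) {a : Γ}
    (ha : a ∉ S) : f.coeff a = 0 := by
  by_contra h
  exact ha (hf h)

theorem single_mem_supportedOn {a : Γ} (ha : a ∈ S) (c : F) :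
    HahnSeries.single a c ∈ supportedOn F S :=
  HahnSeries.support_single_subset.trans (Set.singleton_subset_iff.2 ha)

theorem C_mem_supportedOn (c : F) : HahnSeries.C c ∈ supportedOn F S :=
  single_mem_supportedOn S.zero_mem c

omit [IsOrderedAddMonoid Γ] in
theorem orderTop_single_pos {a : Γ} (ha : 0 < a) (c : F) :
    0 < (HahnSeries.single a c : HahnSeries Γ F).orderTop :=
  (WithTop.coe_pos.2 ha).trans_le HahnSeries.orderTop_single_le

theorem one_sub_single_mul_hsum {a : Γ} (ha : 0 < a) (c : F) :
    (1 - HahnSeries.single a c) * (HahnSeries.SummableFamily.powers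
      (HahnSeries.single a c : HahnSeries Γ F)).hsum = 1 :=
  HahnSeries.SummableFamily.one_sub_self_mul_hsum_powers (orderTop_single_pos ha c)

theorem one_sub_single_ne_zero {a : Γ} (ha : 0 < a) (c : F) :
    (1 - HahnSeries.single a c : HahnSeries Γ F) ≠ 0 :=
  left_ne_zero_of_mul_eq_one (one_sub_single_mul_hsum ha c)

theorem inv_one_sub_single_mem {a : Γ} (ha : 0 < a) (haS : a ∈ S) (c : F) :
    (1 - HahnSeries.single a c)⁻¹ ∈ supportedOn F S := by
  rw [← eq_inv_of_mul_eq_one_right (one_sub_single_mul_hsum ha c)]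
  intro g hg
  obtain ⟨k, hk⟩ : ∃ k, (HahnSeries.SummableFamily.powers
      (HahnSeries.single a c : HahnSeries Γ F) k).coeff g ≠ 0 := by
    by_contra! h
    refine hg ?_
    rw [HahnSeries.SummableFamily.coeff_hsum, finsum_eq_zero_of_forall_eq_zero h]
  rw [HahnSeries.SummableFamily.powers_of_orderTop_pos (orderTop_single_pos ha c)] at hk
  exact (supportedOn F S).pow_mem (single_mem_supportedOn haS c) k hk

theorem single_neg_sub_single {a b : Γ} (c : F) :
    (HahnSeries.single (-a) 1 - HahnSeries.single b c : HahnSeries Γ F) =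
      HahnSeries.single (-a) 1 * (1 - HahnSeries.single (a + b) c) := by
  simp [mul_sub, HahnSeries.single_mul_single]

theorem single_neg_sub_single_ne_zero {a b : Γ} (hab : 0 < a + b) (c : F) :
    (HahnSeries.single (-a) 1 - HahnSeries.single b c : HahnSeries Γ F) ≠ 0 := by
  rw [single_neg_sub_single]
  exact mul_ne_zero (by simp) (one_sub_single_ne_zero hab c)

theorem inv_single_neg_sub_single_mem {a b : Γ} (hab : 0 < a + b) (ha : a ∈ S) (hb : b ∈ S)
    (c : F) : (HahnSeries.single (-a) 1 - HahnSeries.single b c)⁻¹ ∈ supportedOn F S := by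
  rw [single_neg_sub_single, mul_inv, HahnSeries.inv_single, neg_neg]
  exact (supportedOn F S).mul_mem (single_mem_supportedOn ha _)
    (inv_one_sub_single_mem hab (S.add_mem ha hb) c)

end Support

section Rational

variable {ι L : Type*} [DecidableEq ι] [Field L]

theorem prod_sub_mul_div_sub (s : Finset ι) (t y : L) (x : ι → L) (hx : Set.InjOn x s)
    (hy : ∀ i ∈ s, y ≠ x i) :
    ∏ j ∈ s, (y - t * x j) / (y - x j) =
      1 + ∑ a ∈ s, (1 - t) * x a * (∏ j ∈ s.erase a, (x a - t * x j) / (x a - x j)) *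
        (y - x a)⁻¹ := by
  have hdeg : (Lagrange.nodal s (fun j => t * x j) - Lagrange.nodal s x).degree < #s := by
    rw [← Lagrange.degree_nodal (s := s) (v := fun j => t * x j)]
    exact Polynomial.degree_sub_lt_left (by simp only [Lagrange.degree_nodal])
      Lagrange.nodal_ne_zero (by simp only [Lagrange.nodal_monic.leadingCoeff])
  have key := congrArg (Polynomial.eval y) (Lagrange.eq_interpolate hx hdeg)
  rw [Lagrange.eval_interpolate_not_at_node _ hy] at key
  have hne : ∏ j ∈ s, (y - x j) ≠ 0 := prod_ne_zero_iff.2 fun i hi => sub_ne_zero.2 (hy i hi)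
  rw [Polynomial.eval_sub, Lagrange.eval_nodal, Lagrange.eval_nodal, sub_eq_iff_eq_add'] at key
  rw [prod_div_distrib, key, div_eq_iff hne, add_mul, one_mul, mul_comm (∑ _ ∈ s, _)]
  congr 2
  refine sum_congr rfl fun a ha => ?_
  rw [Polynomial.eval_sub, Lagrange.eval_nodal_at_node ha, sub_zero, Lagrange.eval_nodal,
    ← mul_prod_erase s _ ha, Lagrange.nodalWeight, prod_div_distrib, prod_inv_distrib]
  ring

theorem exists_prod_sub_prod_eq_mul {κ : Type*} (A : Subring L) (d : L) (s : Finset κ)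
    (f g : κ → L) (hf : ∀ j ∈ s, f j ∈ A) (hg : ∀ j ∈ s, g j ∈ A)
    (hfg : ∀ j ∈ s, ∃ q ∈ A, f j - g j = d * q) :
    ∃ q ∈ A, ∏ j ∈ s, f j - ∏ j ∈ s, g j = d * q := by
  classical
  induction s using Finset.induction_on with
  | empty => exact ⟨0, A.zero_mem, by simp⟩
  | insert a s ha ih =>
    simp only [mem_insert, forall_eq_or_imp] at hf hg hfg
    obtain ⟨q, hq, e⟩ := ih hf.2 hg.2 hfg.2
    obtain ⟨p, hp, e'⟩ := hfg.1
    refine ⟨p * ∏ j ∈ s, f j + g a * q, A.add_mem (A.mul_mem hp (A.prod_mem hf.2))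
      (A.mul_mem hg.1 hq), ?_⟩
    rw [prod_insert ha, prod_insert ha]
    linear_combination e' * ∏ j ∈ s, f j + g a * e

end Rational

section Lex

variable {r : ℕ}

/-- The exponent of `u_i⁻¹`. -/
def expo (i : Fin r) : Lex (Fin r → ℤ) := toLex (Pi.single (Fin.rev i) 1)

/-- The coordinate of an exponent along `u_i⁻¹`. -/
def coord (i : Fin r) : Lex (Fin r → ℤ) →+ ℤ where
  toFun g := ofLex g (Fin.rev i)
  map_zero' := rfl
  map_add' _ _ := rfl

theorem coord_expo (i j : Fin r) : coord i (expo j) = if i = j then 1 else 0 := by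
  simp [coord, expo, Pi.single_apply]

theorem expo_pos (i : Fin r) : 0 < expo i := by
  refine ⟨Fin.rev i, fun k hk => ?_, ?_⟩
  · change (0 : ℤ) = Pi.single (M := fun _ => ℤ) (Fin.rev i) 1 k
    rw [Pi.single_eq_of_ne hk.ne]
  · change (0 : ℤ) < Pi.single (M := fun _ => ℤ) (Fin.rev i) 1 (Fin.rev i)
    simp

theorem expo_add_neg_pos {i j : Fin r} (hij : i < j) : 0 < expo j + -expo i := by
  have hrev : Fin.rev j < Fin.rev i := Fin.rev_lt_rev.2 hij
  refine ⟨Fin.rev j, fun k hk => ?_, ?_⟩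
  · change (0 : ℤ) = Pi.single (M := fun _ => ℤ) (Fin.rev j) 1 k +
      -Pi.single (M := fun _ => ℤ) (Fin.rev i) 1 k
    rw [Pi.single_eq_of_ne hk.ne, Pi.single_eq_of_ne (hk.trans hrev).ne, neg_zero, add_zero]
  · change (0 : ℤ) < Pi.single (M := fun _ => ℤ) (Fin.rev j) 1 (Fin.rev j) +
      -Pi.single (M := fun _ => ℤ) (Fin.rev i) 1 (Fin.rev j)
    simp [Pi.single_eq_of_ne hrev.ne]

/-- Exponents with no positive power of `u_i⁻¹`. -/
def nonposAt (i : Fin r) : AddSubmonoid (Lex (Fin r → ℤ)) :=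
  (AddSubmonoid.nonneg ℤ).comap (-coord i)

/-- Exponents with no negative power of `u_i⁻¹`. -/
def nonnegAt (i : Fin r) : AddSubmonoid (Lex (Fin r → ℤ)) :=
  (AddSubmonoid.nonneg ℤ).comap (coord i)

/-- Exponents not involving `u_i`. -/
def zeroAt (i : Fin r) : AddSubmonoid (Lex (Fin r → ℤ)) := nonposAt i ⊓ nonnegAt i

theorem mem_nonposAt {i : Fin r} {g} : g ∈ nonposAt i ↔ coord i g ≤ 0 := by
  simp [nonposAt]

theorem mem_nonnegAt {i : Fin r} {g} : g ∈ nonnegAt i ↔ 0 ≤ coord i g := by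
  simp [nonnegAt]

theorem mem_zeroAt {i : Fin r} {g} : g ∈ zeroAt i ↔ coord i g = 0 := by
  simp [zeroAt, mem_nonposAt, mem_nonnegAt, le_antisymm_iff]

end Lex

section Coefficient

variable {F : Type*} [Field F] {r m : ℕ}

/-- The variable `u_i` of the iterated Laurent series field over an arbitrary field. -/
def var (F : Type*) [Field F] (i : Fin r) : HahnSeries (Lex (Fin r → ℤ)) F :=
  HahnSeries.single (-expo i) 1

theorem var_sub_C_ne_zero (i : Fin r) (c : F) : var F i - HahnSeries.C c ≠ 0 :=
  single_neg_sub_single_ne_zero (by rw [add_zero]; exact expo_pos i) c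

theorem var_ne_C (i : Fin r) (c : F) : var F i ≠ HahnSeries.C c :=
  sub_ne_zero.1 (var_sub_C_ne_zero i c)

theorem C_mul_var (i : Fin r) (c : F) :
    HahnSeries.C c * var F i = HahnSeries.single (-expo i) c := by
  simp [var, HahnSeries.C_apply, HahnSeries.single_mul_single]

theorem var_sub_C_mul_var_ne_zero {i j : Fin r} (hij : i < j) (c : F) :
    var F j - HahnSeries.C c * var F i ≠ 0 := by
  rw [C_mul_var]
  exact single_neg_sub_single_ne_zero (expo_add_neg_pos hij) c

theorem var_mem {S : AddSubmonoid (Lex (Fin r → ℤ))} {i : Fin r} (hi : -expo i ∈ S) :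
    var F i ∈ supportedOn F S :=
  single_mem_supportedOn hi 1

theorem inv_var_sub_C_mem {S : AddSubmonoid (Lex (Fin r → ℤ))} {i : Fin r} (hi : expo i ∈ S)
    (c : F) : (var F i - HahnSeries.C c)⁻¹ ∈ supportedOn F S :=
  inv_single_neg_sub_single_mem (by rw [add_zero]; exact expo_pos i) hi S.zero_mem c

theorem inv_var_sub_C_mul_var_mem {S : AddSubmonoid (Lex (Fin r → ℤ))} {i j : Fin r}
    (hij : i < j) (hi : -expo i ∈ S) (hj : expo j ∈ S) (c : F) :
    (var F j - HahnSeries.C c * var F i)⁻¹ ∈ supportedOn F S := by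
  rw [C_mul_var]
  exact inv_single_neg_sub_single_mem (expo_add_neg_pos hij) hj hi c

theorem expo_mem_zeroAt {i j : Fin r} (hij : i ≠ j) : expo j ∈ zeroAt i := by
  simp [mem_zeroAt, coord_expo, hij]

theorem neg_mem_zeroAt {i : Fin r} {g : Lex (Fin r → ℤ)} (hg : g ∈ zeroAt i) :
    -g ∈ zeroAt i := by
  simpa [mem_zeroAt] using hg

theorem coeff_inv_var_sub_C_mul {k : Fin r} {c : F} {G : HahnSeries (Lex (Fin r → ℤ)) F}
    (hG : G ∈ supportedOn F (zeroAt k)) {g : Lex (Fin r → ℤ)} (hg : coord k g = 0) (l : ℕ) :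
    ((var F k - HahnSeries.C c)⁻¹ * G).coeff (g + (l + 1) • expo k) = c ^ l * G.coeff g := by
  set h := (var F k - HahnSeries.C c)⁻¹ * G with hh
  have hrec (b : Lex (Fin r → ℤ)) : h.coeff (b + expo k) = c * h.coeff b + G.coeff b := by
    have e : var F k * h = HahnSeries.C c * h + G := by
      rw [← sub_eq_iff_eq_add', ← sub_mul, hh, mul_inv_cancel_left₀ (var_sub_C_ne_zero k c)]
    have := congrArg (fun f => f.coeff b) e
    simpa [var, HahnSeries.coeff_single_mul, HahnSeries.C_mul_eq_smul] using this
  have hzero : h.coeff g = 0 := by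
    have hmem : var F k * h ∈ supportedOn F (nonnegAt k) := by
      have : var F k * h = (1 - HahnSeries.single (expo k) c)⁻¹ * G := by
        have e := single_neg_sub_single (a := expo k) (b := 0) c
        rw [add_zero] at e
        rw [hh, HahnSeries.C_apply, var, e, mul_inv, mul_assoc, mul_inv_cancel_left₀ (by simp)]
      rw [this]
      exact Subring.mul_mem _ (inv_one_sub_single_mem (expo_pos k)
        (by simp [mem_nonnegAt, coord_expo]) c) (supportedOn_mono inf_le_right hG)
    have := coeff_eq_zero_of_mem hmem (a := g - expo k)
      (by simp [mem_nonnegAt, coord_expo, hg])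
    simpa [var, HahnSeries.coeff_single_mul] using this
  induction l with
  | zero => simp [hrec, hzero]
  | succ l ih =>
    have hG0 : G.coeff (g + (l + 1) • expo k) = 0 := by
      refine coeff_eq_zero_of_mem hG ?_
      simp only [mem_zeroAt, map_add, map_nsmul, coord_expo, hg]
      simp
      omega
    rw [succ_nsmul, ← add_assoc, hrec, ih, hG0, pow_succ', mul_assoc, add_zero]

/-- The product `∏_j (u_{v j} - y) / (u_{v j} - t y)`. -/
def crossFactor (v : Fin m → Fin r) (t : F) (y : HahnSeries (Lex (Fin r → ℤ)) F) :
    HahnSeries (Lex (Fin r → ℤ)) F :=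
  ∏ j, (var F (v j) - y) / (var F (v j) - HahnSeries.C t * y)

variable {k : Fin r} {v : Fin m → Fin r}

theorem zeroAt_le_nonposAt : zeroAt k ≤ nonposAt k := inf_le_left

theorem var_mem_zeroAt {j : Fin r} (h : k < j) : var F j ∈ supportedOn F (zeroAt k) :=
  var_mem (neg_mem_zeroAt (expo_mem_zeroAt h.ne))

theorem crossFactor_C_mem (hv : ∀ j, k < v j) (t c : F) :
    crossFactor v t (HahnSeries.C c) ∈ supportedOn F (zeroAt k) := by
  refine Subring.prod_mem _ fun j _ => ?_
  rw [div_eq_mul_inv, ← map_mul]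
  exact Subring.mul_mem _ (Subring.sub_mem _ (var_mem_zeroAt (hv j)) (C_mem_supportedOn c))
    (inv_var_sub_C_mem (expo_mem_zeroAt (hv j).ne) _)

theorem exists_crossFactor_sub (hv : ∀ j, k < v j) (t c : F) :
    ∃ q ∈ supportedOn F (nonposAt k), crossFactor v t (var F k) -
      crossFactor v t (HahnSeries.C c) = (var F k - HahnSeries.C c) * q := by
  have hu : var F k ∈ supportedOn F (nonposAt k) :=
    var_mem (by simp [mem_nonposAt, coord_expo])
  have huj j : var F (v j) ∈ supportedOn F (nonposAt k) :=
    supportedOn_mono zeroAt_le_nonposAt (var_mem_zeroAt (hv j))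
  have hC (c : F) : HahnSeries.C c ∈ supportedOn F (nonposAt k) := C_mem_supportedOn c
  have hi1 j : (var F (v j) - HahnSeries.C t * var F k)⁻¹ ∈ supportedOn F (nonposAt k) :=
    inv_var_sub_C_mul_var_mem (hv j) (by simp [mem_nonposAt, coord_expo])
      (zeroAt_le_nonposAt (expo_mem_zeroAt (hv j).ne)) t
  have hi2 j : (var F (v j) - HahnSeries.C t * HahnSeries.C c)⁻¹ ∈
      supportedOn F (nonposAt k) := by
    rw [← map_mul]
    exact inv_var_sub_C_mem (zeroAt_le_nonposAt (expo_mem_zeroAt (hv j).ne)) _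
  refine exists_prod_sub_prod_eq_mul _ _ _ _ _ (fun j _ => ?_) (fun j _ => ?_) fun j _ => ?_
  · exact Subring.mul_mem _ (Subring.sub_mem _ (huj j) hu) (hi1 j)
  · exact Subring.mul_mem _ (Subring.sub_mem _ (huj j) (hC c)) (hi2 j)
  · refine ⟨var F (v j) * (HahnSeries.C t - 1) * ((var F (v j) - HahnSeries.C t * var F k)⁻¹ *
      (var F (v j) - HahnSeries.C t * HahnSeries.C c)⁻¹), Subring.mul_mem _ (Subring.mul_mem _
      (huj j) (Subring.sub_mem _ (hC t) (Subring.one_mem _))) (Subring.mul_mem _ (hi1 j) (hi2 j)),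
      ?_⟩
    have h1 := var_sub_C_mul_var_ne_zero (hv j) t
    have h2 : var F (v j) - HahnSeries.C t * HahnSeries.C c ≠ 0 := by
      rw [← map_mul]
      exact var_sub_C_ne_zero _ _
    rw [div_sub_div _ _ h1 h2, ← mul_inv, ← mul_assoc, ← div_eq_mul_inv]
    congr 1
    ring

variable {ι : Type*} [DecidableEq ι]

/-- The coefficient extraction in the innermost variable `u_k`. -/
theorem coeff_prod_mul_crossFactor_mul {x : ι → F} (hx : Function.Injective x) (s : Finset ι)
    (t : F) (hv : ∀ j, k < v j) {P : HahnSeries (Lex (Fin r → ℤ)) F}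
    (hP : P ∈ supportedOn F (zeroAt k)) {g : Lex (Fin r → ℤ)} (hg : coord k g = 0)
    {l : ℕ} (hl : 0 < l) :
    ((∏ j ∈ s, (var F k - HahnSeries.C t * HahnSeries.C (x j)) /
        (var F k - HahnSeries.C (x j))) * crossFactor v t (var F k) * P).coeff (g + l • expo k) =
      ∑ a ∈ s, (1 - t) * (x a ^ l * (∏ j ∈ s.erase a, (x a - t * x j) / (x a - x j)) *
        (crossFactor v t (HahnSeries.C (x a)) * P).coeff g) := by
  obtain ⟨l, rfl⟩ := Nat.exists_eq_add_one.2 hl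
  have hvanish {f : HahnSeries (Lex (Fin r → ℤ)) F} (hf : f ∈ supportedOn F (nonposAt k)) :
      f.coeff (g + (l + 1) • expo k) = 0 := by
    refine coeff_eq_zero_of_mem hf ?_
    simp only [mem_nonposAt, map_add, map_nsmul, coord_expo, hg]
    simp
  have hP' := supportedOn_mono zeroAt_le_nonposAt hP
  choose q hq hqe using fun a => exists_crossFactor_sub hv t (x a)
  have hB : crossFactor v t (var F k) ∈ supportedOn F (nonposAt k) := by
    obtain ⟨q, hq, h⟩ := exists_crossFactor_sub hv t (0 : F)
    rw [sub_eq_iff_eq_add] at h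
    rw [h]
    exact Subring.add_mem _ (Subring.mul_mem _ (Subring.sub_mem _
      (var_mem (by simp [mem_nonposAt, coord_expo])) (C_mem_supportedOn _)) hq)
      (supportedOn_mono zeroAt_le_nonposAt (crossFactor_C_mem hv t 0))
  rw [prod_sub_mul_div_sub s (HahnSeries.C t) (var F k) (fun j => HahnSeries.C (x j))
    (HahnSeries.C_injective.comp hx).injOn fun i _ => var_ne_C k (x i)]
  have hsplit : (1 + ∑ a ∈ s, (1 - HahnSeries.C t) * HahnSeries.C (x a) *
        (∏ j ∈ s.erase a, (HahnSeries.C (x a) - HahnSeries.C t * HahnSeries.C (x j)) /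
          (HahnSeries.C (x a) - HahnSeries.C (x j))) * (var F k - HahnSeries.C (x a))⁻¹) *
        crossFactor v t (var F k) * P =
      crossFactor v t (var F k) * P + ∑ a ∈ s, HahnSeries.C ((1 - t) * x a *
        ∏ j ∈ s.erase a, (x a - t * x j) / (x a - x j)) * ((var F k - HahnSeries.C (x a))⁻¹ *
          (crossFactor v t (HahnSeries.C (x a)) * P) + q a * P) := by
    rw [add_mul, add_mul, one_mul, sum_mul, sum_mul]
    congr 1
    refine sum_congr rfl fun a _ => ?_
    have e : crossFactor v t (var F k) * (var F k - HahnSeries.C (x a))⁻¹ =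
        (var F k - HahnSeries.C (x a))⁻¹ * crossFactor v t (HahnSeries.C (x a)) + q a := by
      rw [sub_eq_iff_eq_add.1 (hqe a)]
      rw [add_mul, mul_right_comm, mul_inv_cancel₀ (var_sub_C_ne_zero k (x a))]
      ring
    simp only [map_mul, map_sub, map_one, map_prod, map_div₀]
    linear_combination ((1 - HahnSeries.C t) * HahnSeries.C (x a) *
        (∏ j ∈ s.erase a, (HahnSeries.C (x a) - HahnSeries.C t * HahnSeries.C (x j)) /
          (HahnSeries.C (x a) - HahnSeries.C (x j)))) * P * e
  rw [hsplit, HahnSeries.coeff_add, hvanish (Subring.mul_mem _ hB hP'), zero_add,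
    HahnSeries.coeff_sum]
  refine sum_congr rfl fun a _ => ?_
  rw [HahnSeries.C_mul_eq_smul, HahnSeries.coeff_smul, HahnSeries.coeff_add,
    hvanish (Subring.mul_mem _ (hq a) hP'), coeff_inv_var_sub_C_mul
      (Subring.mul_mem _ (crossFactor_C_mem hv t _) hP) hg, smul_eq_mul]
  ring

/-- The generating function in the variables `u_{v 0}, …, u_{v (m-1)}` and `x_j`, `j ∈ s`,
without the power of `1 - t`. -/
def genFun (t : F) (x : ι → F) (v : Fin m → Fin r) (s : Finset ι) :
    HahnSeries (Lex (Fin r → ℤ)) F :=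
  (∏ i, ∏ j ∈ s, (var F (v i) - HahnSeries.C t * HahnSeries.C (x j)) /
      (var F (v i) - HahnSeries.C (x j))) *
    ∏ i, ∏ j ∈ Ioi i, (var F (v j) - var F (v i)) /
      (var F (v j) - HahnSeries.C t * var F (v i))

omit [DecidableEq ι] in
theorem genFun_succ (t : F) (x : ι → F) (v : Fin (m + 1) → Fin r) (s : Finset ι) :
    genFun t x v s = (∏ j ∈ s, (var F (v 0) - HahnSeries.C t * HahnSeries.C (x j)) /
      (var F (v 0) - HahnSeries.C (x j))) * crossFactor (v ∘ Fin.succ) t (var F (v 0)) *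
        genFun t x (v ∘ Fin.succ) s := by
  simp only [genFun, crossFactor, Fin.prod_univ_succ, Fin.prod_Ioi_zero, Fin.prod_Ioi_succ,
    Function.comp_apply]
  ring

theorem crossFactor_mul_genFun (t : F) (x : ι → F) (v : Fin m → Fin r) {s : Finset ι} {a : ι}
    (ha : a ∈ s) : crossFactor v t (HahnSeries.C (x a)) * genFun t x v s =
      genFun t x v (s.erase a) := by
  rw [genFun, genFun, ← mul_assoc, crossFactor, ← prod_mul_distrib]
  congr 1
  refine prod_congr rfl fun i _ => ?_
  have h : var F (v i) - HahnSeries.C t * HahnSeries.C (x a) ≠ 0 := by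
    rw [← map_mul]
    exact var_sub_C_ne_zero _ _
  rw [← mul_prod_erase s _ ha, ← mul_assoc, div_mul_div_cancel₀ h,
    div_self (var_sub_C_ne_zero _ _), one_mul]

omit [DecidableEq ι] in
theorem genFun_mem (t : F) (x : ι → F) (hmono : StrictMono v) (hv : ∀ j, k < v j)
    (s : Finset ι) : genFun t x v s ∈ supportedOn F (zeroAt k) := by
  refine Subring.mul_mem _ (Subring.prod_mem _ fun i _ => Subring.prod_mem _ fun j _ => ?_)
    (Subring.prod_mem _ fun i _ => Subring.prod_mem _ fun j hj => ?_)
  · rw [← map_mul]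
    exact Subring.mul_mem _ (Subring.sub_mem _ (var_mem_zeroAt (hv i)) (C_mem_supportedOn _))
      (inv_var_sub_C_mem (expo_mem_zeroAt (hv i).ne) _)
  · exact Subring.mul_mem _ (Subring.sub_mem _ (var_mem_zeroAt (hv j)) (var_mem_zeroAt (hv i)))
      (inv_var_sub_C_mul_var_mem (hmono (mem_Ioi.1 hj))
        (neg_mem_zeroAt (expo_mem_zeroAt (hv i).ne)) (expo_mem_zeroAt (hv j).ne) t)

/-- The Hall–Littlewood sum over sequences of distinct elements of `s`, defined by choosing
the first element of the sequence. -/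
def hlSum (t : F) (x : ι → F) : (m : ℕ) → (Fin m → ℕ) → Finset ι → F
  | 0, _, _ => 1
  | m + 1, l, s => ∑ a ∈ s, x a ^ l 0 * (∏ j ∈ s.erase a, (x a - t * x j) / (x a - x j)) *
      hlSum t x m (l ∘ Fin.succ) (s.erase a)

theorem coeff_genFun (t : F) {x : ι → F} (hx : Function.Injective x) (hmono : StrictMono v)
    (l : Fin m → ℕ) (hl : ∀ i, 0 < l i) (s : Finset ι) :
    (genFun t x v s).coeff (∑ i, l i • expo (v i)) = (1 - t) ^ m * hlSum t x m l s := by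
  induction m generalizing s with
  | zero => simp [genFun, hlSum]
  | succ m ih =>
    have hv (j : Fin m) : v 0 < (v ∘ Fin.succ) j := hmono (Fin.succ_pos j)
    have hmono' : StrictMono (v ∘ Fin.succ) := hmono.comp Fin.strictMono_succ
    rw [genFun_succ, Fin.sum_univ_succ, add_comm (l 0 • _),
      coeff_prod_mul_crossFactor_mul hx s t hv (genFun_mem t x hmono' hv s) _ (hl 0), hlSum, mul_sum]
    · refine sum_congr rfl fun a ha => ?_
      rw [crossFactor_mul_genFun t x _ ha]
      have := ih hmono' (l ∘ Fin.succ) (fun i => hl _) (s.erase a)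
      simp only [Function.comp_apply] at this
      rw [this]
      ring
    · rw [map_sum]
      refine sum_eq_zero fun i _ => ?_
      rw [map_nsmul, coord_expo, if_neg (hmono (Fin.succ_pos i)).ne, nsmul_zero]

end Coefficient

section Permutations

variable {F : Type*} [Field F]

theorem hlSum_eq_sum_injective {ι : Type*} [DecidableEq ι] [Fintype ι] (t : F) (x : ι → F)
    (m : ℕ) (l : Fin m → ℕ) (s : Finset ι) :
    hlSum t x m l s = ∑ a : Fin m → ι with Function.Injective a ∧ ∀ i, a i ∈ s,
      (∏ i, x (a i) ^ l i) *
        ∏ i, ∏ j ∈ s \ (Iic i).image a, (x (a i) - t * x j) / (x (a i) - x j) := by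
  induction m generalizing s with
  | zero =>
    rw [hlSum, sum_filter]
    simp [Function.injective_of_subsingleton]
  | succ m ih =>
    simp only [hlSum, ih, mul_sum]
    rw [sum_sigma']
    refine sum_bij' (fun p _ => Fin.cons p.1 p.2) (fun a _ => ⟨a 0, Fin.tail a⟩) ?_ ?_ ?_ ?_ ?_
    · rintro ⟨b, f⟩ h
      simp only [mem_sigma, mem_filter, mem_univ, true_and, mem_erase] at h ⊢
      refine ⟨Fin.cons_injective_iff.2 ⟨?_, h.2.1⟩, Fin.forall_fin_succ.2 ⟨h.1, fun i => ?_⟩⟩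
      · rintro ⟨i, hi⟩
        exact (h.2.2 i).1 hi
      · simpa using (h.2.2 i).2
    · intro a h
      simp only [mem_sigma, mem_filter, mem_univ, true_and, mem_erase] at h ⊢
      exact ⟨h.2 0, h.1.comp (Fin.succ_injective m),
        fun i => ⟨fun e => Fin.succ_ne_zero i (h.1 e), h.2 _⟩⟩
    · rintro ⟨b, f⟩ h
      simp
    · intro a h
      simp
    · rintro ⟨b, f⟩ h
      have h0 : s \ (Iic (0 : Fin (m + 1))).image (Fin.cons b f) = s.erase b := by
        ext j
        simp [eq_comm, and_comm]
      have hs (i : Fin m) : s \ (Iic i.succ).image (Fin.cons b f) =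
          s.erase b \ (Iic i).image f := by
        ext j
        simp [Fin.exists_fin_succ, eq_comm]
        tauto
      simp only [Fin.prod_univ_succ, Fin.cons_zero, Fin.cons_succ, h0, hs, Function.comp_apply]
      ring

theorem sum_Cperm {M : Type*} [AddCommMonoid M] {r n : ℕ} (hrn : r ≤ n)
    (φ : (Fin r → Fin n) → M) :
    ∑ w ∈ Cperm r n, φ (fun i => w (Fin.castLE hrn i)) =
      ∑ a : Fin r → Fin n with Function.Injective a, φ a := by
  have hcard {a : Fin r → Fin n} (ha : Function.Injective a) : #(univ.image a)ᶜ = n - r := by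
    rw [card_compl, card_image_of_injective _ ha, card_univ, Fintype.card_fin, Fintype.card_fin]
  refine sum_bij (fun w _ i => w (Fin.castLE hrn i)) ?_ ?_ ?_ fun _ _ => rfl
  · intro w _
    exact mem_filter.2 ⟨mem_univ _, w.injective.comp (Fin.castLE_injective hrn)⟩
  · intro w hw w' hw' h
    have ha : Function.Injective fun i => w (Fin.castLE hrn i) :=
      w.injective.comp (Fin.castLE_injective hrn)
    have hrest (v : Equiv.Perm (Fin n)) (hv : v ∈ Cperm r n)
        (hvw : ∀ i, v (Fin.castLE hrn i) = w (Fin.castLE hrn i)) :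
        (fun k : Fin (n - r) => v ⟨r + k, by omega⟩) =
          (univ.image fun i => w (Fin.castLE hrn i))ᶜ.orderEmbOfFin (hcard ha) := by
      refine orderEmbOfFin_unique _ (fun k => ?_) fun k k' hk => ?_
      · simp only [mem_compl, mem_image, mem_univ, true_and, not_exists, ← hvw]
        intro i hi
        have hik := congrArg Fin.val (v.injective hi)
        rw [Fin.val_castLE] at hik
        change (i : ℕ) = r + k at hik
        omega
      · exact (mem_filter.1 hv).2 _ _ (Nat.le_add_right _ _)
          (Fin.lt_def.2 (Nat.add_lt_add_left hk r))
    have hlast := (hrest w hw fun _ => rfl).trans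
      (hrest w' hw' fun i => (congrFun h i).symm).symm
    ext i : 1
    obtain hi | hi := lt_or_ge (i : ℕ) r
    · exact congrFun h ⟨i, hi⟩
    · have hir : (⟨r + (i - r), by omega⟩ : Fin n) = i := Fin.ext (Nat.add_sub_cancel' hi)
      have := congrFun hlast ⟨i - r, by omega⟩
      simpa only [hir] using this
  · intro a ha
    replace ha : Function.Injective a := by simpa using ha
    let e := (univ.image a)ᶜ.orderEmbOfFin (hcard ha)
    have hae (i k) : a i ≠ e k := by
      have := orderEmbOfFin_mem (univ.image a)ᶜ (hcard ha) k
      simp only [mem_compl, mem_image, mem_univ, true_and, not_exists] at this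
      exact this i
    let f : Fin n → Fin n := fun i =>
      if h : (i : ℕ) < r then a ⟨i, h⟩ else e ⟨i - r, by omega⟩
    have hf : Function.Injective f := by
      intro i j hij
      by_cases hi : (i : ℕ) < r <;> by_cases hj : (j : ℕ) < r <;>
        simp only [f, hi, hj, dif_pos, dif_neg, not_false_eq_true] at hij
      · simpa [Fin.ext_iff] using ha hij
      · exact absurd hij (hae _ _)
      · exact absurd hij.symm (hae _ _)
      · have := congrArg Fin.val (e.injective hij)
        simp only at this
        omega
    refine ⟨Equiv.ofBijective f (Finite.injective_iff_bijective.1 hf),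
      mem_filter.2 ⟨mem_univ _, fun i j hi hij => ?_⟩, ?_⟩
    · have hj : r ≤ (j : ℕ) := hi.trans hij.le
      simp only [Equiv.ofBijective_apply, f, hi.not_gt, hj.not_gt, dif_neg, not_false_eq_true]
      exact e.strictMono (Fin.lt_def.2 (by simp only; omega))
    · funext i
      simp [f]

theorem sum_Cperm_eq_hlSum (t : F) {r n : ℕ} (hrn : r ≤ n) (x : Fin n → F) (l : Fin r → ℕ) :
    ∑ w ∈ Cperm r n, (∏ i : Fin r, x (w (Fin.castLE hrn i)) ^ l i) *
        (∏ i : Fin r, ∏ j ∈ Ioi (Fin.castLE hrn i),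
          (x (w (Fin.castLE hrn i)) - t * x (w j)) / (x (w (Fin.castLE hrn i)) - x (w j))) =
      hlSum t x r l univ := by
  simp only [hlSum_eq_sum_injective, mem_univ, implies_true, and_true]
  rw [← sum_Cperm hrn]
  refine sum_congr rfl fun w _ => ?_
  congr 1
  refine prod_congr rfl fun i _ => ?_
  have h : univ \ (Iic i).image (fun i => w (Fin.castLE hrn i)) =
      (Ioi (Fin.castLE hrn i)).image w := by
    ext j
    simp only [mem_sdiff, mem_univ, true_and, mem_image, mem_Iic, mem_Ioi, not_exists, not_and]
    constructor
    · intro hj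
      refine ⟨w.symm j, ?_, w.apply_symm_apply j⟩
      by_contra! hle
      refine hj ⟨w.symm j, lt_of_le_of_lt (Fin.le_def.1 hle) i.2⟩ (Fin.le_def.2 hle) ?_
      exact w.apply_symm_apply j
    · rintro ⟨k, hk, rfl⟩ i' hi' e
      rw [← w.injective e] at hk
      exact absurd (Fin.lt_def.1 hk) (not_lt.2 (Fin.le_def.1 hi'))
  rw [h, prod_image w.injective.injOn]

end Permutations

theorem x_injective (n : ℕ) : Function.Injective (x n) := fun _ _ h =>
  Sum.inl_injective (MvPolynomial.X_injective
    (IsFractionRing.injective (MvPolynomial (Fin n ⊕ Unit) ℚ) (K n) h))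

theorem one_sub_t_ne_zero (n : ℕ) : 1 - t n ≠ 0 := by
  intro h
  have h1 : algebraMap (MvPolynomial (Fin n ⊕ Unit) ℚ) (K n) 1 =
      algebraMap (MvPolynomial (Fin n ⊕ Unit) ℚ) (K n) (MvPolynomial.X (Sum.inr ())) := by
    rw [map_one]
    exact sub_eq_zero.1 h
  have h2 := congrArg (MvPolynomial.eval 0)
    (IsFractionRing.injective (MvPolynomial (Fin n ⊕ Unit) ℚ) (K n) h1)
  simp at h2

theorem u_eq_var (n r : ℕ) (i : Fin r) : u n r i = var (K n) i := by
  have : -expo i = toLex (Pi.single (Fin.rev i) (-1 : ℤ)) := by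
    rw [Pi.single_neg]
    rfl
  rw [var, this, u]

theorem sum_smul_expo {r : ℕ} (l : Fin r → ℕ) :
    ∑ i, l i • expo i = toLex fun k : Fin r => (l (Fin.rev k) : ℤ) := by
  apply ofLex.injective
  funext k
  obtain ⟨j, rfl⟩ := Fin.rev_surjective k
  have h : coord j (∑ i, l i • expo i) = l (Fin.rev (Fin.rev j)) := by
    rw [map_sum]
    simp only [map_nsmul, coord_expo]
    simp
  exact h

end HallLittlewood

/-- **Generating function for the Hall–Littlewood `P`-type coset symmetrizations
(additive specialization of the universal Hall–Littlewood `P`-functions).**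

For a partition `λ_1 ≥ ⋯ ≥ λ_r > 0` of length `r ≤ n`,
`HP_λ(x_n;t) = Σ_{w∈C(r,n)} w·( ∏_i x_i^{λ_i} · ∏_i ∏_{j=i+1}^n (x_i−tx_j)/(x_i−x_j) )`
equals the coefficient of `u_1^{−λ_1}⋯u_r^{−λ_r}` in
`(1−t)^{−r} ∏_i ∏_{j=1}^n (u_i−tx_j)/(u_i−x_j) · ∏_{1≤i<j≤r} (u_j−u_i)/(u_j−tu_i)`. -/
theorem hall_littlewood_P_generating_function
    (n r : ℕ) (hr : 1 ≤ r) (hrn : r ≤ n)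
    (lam : Fin r → ℕ) (hpos : ∀ i, 0 < lam i)
    (hanti : ∀ i j : Fin r, i ≤ j → lam j ≤ lam i) :
    (∑ w ∈ Cperm r n,
      (∏ i : Fin r, x n (w (Fin.castLE hrn i)) ^ (lam i)) *
      (∏ i : Fin r, ∏ j ∈ Finset.Ioi (Fin.castLE hrn i),
          (x n (w (Fin.castLE hrn i)) - t n * x n (w j)) /
          (x n (w (Fin.castLE hrn i)) - x n (w j))))
    =
    ((((1 - HahnSeries.C (t n) : H n r) ^ r)⁻¹) *
      (∏ i : Fin r, ∏ j : Fin n,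
        (u n r i - HahnSeries.C (t n) * HahnSeries.C (x n j)) /
        (u n r i - HahnSeries.C (x n j))) *
      (∏ i : Fin r, ∏ j ∈ Finset.Ioi i,
        (u n r j - u n r i) / (u n r j - HahnSeries.C (t n) * u n r i))).coeff
        (toLex (fun k : Fin r => (lam (Fin.rev k) : ℤ))) := by
  have key := HallLittlewood.coeff_genFun (t n) (HallLittlewood.x_injective n)
    (v := id) (r := r) strictMono_id lam hpos univ
  rw [HallLittlewood.sum_Cperm_eq_hlSum (t n) hrn (x n) lam, mul_assoc]
  simp only [id, HallLittlewood.sum_smul_expo, HallLittlewood.genFun] at key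
  simp only [HallLittlewood.u_eq_var]
  rw [← map_one HahnSeries.C, ← map_sub, ← map_pow, ← map_inv₀, HahnSeries.C_mul_eq_smul,
    HahnSeries.coeff_smul, key, smul_eq_mul,
    inv_mul_cancel_left₀ (pow_ne_zero _ (HallLittlewood.one_sub_t_ne_zero n))]
end
end
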